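/- arXiv:1702.00466 — 2 statements merged into one kernel-verified Lean document; each statement's English description precedes it below -/
import Mathlib

section
/- Every minimizer μ_a of I over M_a satisfies μ_a(Γ) = a, i.e. the constraint μ(Γ) ≥ a is attained with equality at the minimizer. -/
open MeasureTheory Real
open scoped ENNReal

abbrev Plane : Type := EuclideanSpace ℝ (Fin 2)

noncomputable def logKernel (x y : Plane) : ℝ := Real.log (1 / dist x y)

/- The integrand `log(1/|x-y|) + (|x|²+|y|²)/2 + 1` is nonnegative, and for a
probability measure `μ` the quantity `wEnergy μ` below equals `I[μ] + 1`, where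
`I[μ] = ∫∫ log(1/|x-y|) dμdμ + ∫ |x|² dμ` (with value `+∞` allowed; the value of
the kernel on the diagonal is `+∞`). -/
open Classical in
noncomputable def wKernel (x y : Plane) : ℝ≥0∞ :=
  if x = y then ⊤ else ENNReal.ofReal (logKernel x y + (‖x‖ ^ 2 + ‖y‖ ^ 2) / 2 + 1)

noncomputable def wEnergy (μ : Measure Plane) : ℝ≥0∞ :=
  ∫⁻ p : Plane × Plane, wKernel p.1 p.2 ∂(μ.prod μ)

def Ma (Γ : Set Plane) (a : ℝ) : Set (Measure Plane) :=
  {μ | IsProbabilityMeasure μ ∧ ENNReal.ofReal a ≤ μ Γ}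

/-- `μa` is a minimizer of `I` over `M_a`: it lies in `M_a`, has finite energy,
and minimizes the energy. -/
def IsMinimizer (Γ : Set Plane) (a : ℝ) (μa : Measure Plane) : Prop :=
  μa ∈ Ma Γ a ∧ wEnergy μa < ⊤ ∧ ∀ μ ∈ Ma Γ a, wEnergy μa ≤ wEnergy μ

structure RegularCurve (γ : ℝ → Plane) (Γ : Set Plane) : Prop where
  injective : Function.Injective γ
  image : Γ = Set.range γ
  closed : IsClosed Γ
  contDiff : ContDiff ℝ 1 γ
  unitSpeed : ∀ t, ‖deriv γ t‖ = 1
  holder : ∃ α : ℝ, α ∈ Set.Ioc (0:ℝ) 1 ∧ ∃ M : ℝ, 0 ≤ M ∧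
    ∀ s t : ℝ, ‖deriv γ t - deriv γ s‖ ≤ M * |t - s| ^ α

lemma logKernel_add_nonneg (x y : Plane) :
    0 ≤ logKernel x y + (‖x‖ ^ 2 + ‖y‖ ^ 2) / 2 + 1 := by
  rw [logKernel, one_div, Real.log_inv]
  rcases eq_or_ne x y with h | h
  · subst h
    simp only [dist_self, Real.log_zero]
    positivity
  have h1 := Real.log_le_sub_one_of_pos (dist_pos.2 h)
  have h2 : dist x y ≤ ‖x‖ + ‖y‖ := dist_le_norm_add_norm x y
  nlinarith [sq_nonneg (‖x‖ - 1), sq_nonneg (‖y‖ - 1)]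

lemma wKernel_comm (x y : Plane) : wKernel x y = wKernel y x := by
  simp only [wKernel, logKernel, eq_comm (a := x), dist_comm x, add_comm (‖x‖ ^ 2)]

lemma measurable_wKernel : Measurable (fun p : Plane × Plane => wKernel p.1 p.2) := by
  unfold wKernel logKernel
  refine Measurable.ite (measurableSet_eq_fun measurable_fst measurable_snd) measurable_const ?_
  fun_prop

/-- The mutual weighted energy of two measures. -/
noncomputable def mutualEnergy (μ ν : Measure Plane) : ℝ≥0∞ :=
  ∫⁻ x, ∫⁻ y, wKernel x y ∂ν ∂μ

lemma wEnergy_eq_mutualEnergy (μ : Measure Plane) [SFinite μ] :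
    wEnergy μ = mutualEnergy μ μ :=
  lintegral_prod _ measurable_wKernel.aemeasurable

lemma measurable_potential (μ : Measure Plane) [SFinite μ] :
    Measurable (fun x => ∫⁻ y, wKernel x y ∂μ) :=
  measurable_wKernel.lintegral_prod_right'

lemma mutualEnergy_comm (μ ν : Measure Plane) [SFinite μ] [SFinite ν] :
    mutualEnergy μ ν = mutualEnergy ν μ := by
  unfold mutualEnergy
  rw [lintegral_lintegral_swap measurable_wKernel.aemeasurable]
  simp only [wKernel_comm]

lemma mutualEnergy_add_smul (μ ν : Measure Plane) [IsFiniteMeasure μ] [IsFiniteMeasure ν]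
    (s t : ℝ≥0∞) :
    mutualEnergy (s • μ + t • ν) (s • μ + t • ν) =
      s * s * mutualEnergy μ μ + 2 * s * t * mutualEnergy ν μ + t * t * mutualEnergy ν ν := by
  have hc := mutualEnergy_comm μ ν
  unfold mutualEnergy at *
  have h1 := measurable_potential μ
  have h2 := measurable_potential ν
  simp only [lintegral_add_measure, lintegral_smul_measure, smul_eq_mul]
  rw [lintegral_add_left (by fun_prop), lintegral_add_left (by fun_prop)]
  rw [lintegral_const_mul _ h1, lintegral_const_mul _ h1, lintegral_const_mul _ h2,
    lintegral_const_mul _ h2, hc]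
  ring

/-- First variation: if the constraint is not active, moving mass from the minimizer to any
competitor of finite energy does not decrease the energy. -/
lemma IsMinimizer.wEnergy_le_mutualEnergy {Γ : Set Plane} {a : ℝ} (ha : 0 < a) {μ : Measure Plane}
    (hmin : IsMinimizer Γ a μ) (hlt : ENNReal.ofReal a < μ Γ)
    (ν : Measure Plane) [IsProbabilityMeasure ν] (hν : wEnergy ν < ⊤) :
    wEnergy μ ≤ mutualEnergy ν μ := by
  obtain ⟨⟨hp, -⟩, hE, hm⟩ := hmin
  by_contra! hcon
  have hx : mutualEnergy ν μ ≠ ⊤ := (hcon.trans hE).ne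
  lift a to NNReal using ha.le
  set m := (μ Γ).toReal with hmdef
  have hmΓ : μ Γ = ENNReal.ofReal m := (ENNReal.ofReal_toReal (measure_ne_top _ _)).symm
  have ham : (a : ℝ) < m := by
    rw [hmΓ] at hlt
    exact (ENNReal.ofReal_lt_ofReal_iff_of_nonneg a.2).1 hlt
  have hmp : 0 < m := ha.trans ham
  set e := (wEnergy μ).toReal
  set x := (mutualEnergy ν μ).toReal
  set f := (wEnergy ν).toReal
  have he : wEnergy μ = ENNReal.ofReal e := (ENNReal.ofReal_toReal hE.ne).symm
  have hxe : mutualEnergy ν μ = ENNReal.ofReal x := (ENNReal.ofReal_toReal hx).symm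
  have hf : wEnergy ν = ENNReal.ofReal f := (ENNReal.ofReal_toReal hν.ne).symm
  have he0 : 0 ≤ e := ENNReal.toReal_nonneg
  have hx0 : 0 ≤ x := ENNReal.toReal_nonneg
  have hf0 : 0 ≤ f := ENNReal.toReal_nonneg
  have hxlt : x < e := by
    rw [he, hxe] at hcon
    exact (ENNReal.ofReal_lt_ofReal_iff_of_nonneg hx0).1 hcon
  have key : ∀ t : ℝ, 0 < t → t < 1 → (a : ℝ) ≤ (1 - t) * m →
      e ≤ (1 - t) * (1 - t) * e + 2 * (1 - t) * t * x + t * t * f := by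
    intro t ht0 ht1 hta
    have h1t : 0 ≤ 1 - t := by linarith
    set ρ := ENNReal.ofReal (1 - t) • μ + ENNReal.ofReal t • ν with hρ
    have hρp : IsProbabilityMeasure ρ := by
      constructor
      simp only [hρ, Measure.add_apply, Measure.smul_apply, measure_univ, smul_eq_mul, mul_one]
      rw [← ENNReal.ofReal_add h1t ht0.le]
      simp
    have hmem : ρ ∈ Ma Γ a := by
      refine ⟨hρp, ?_⟩
      calc ENNReal.ofReal a ≤ ENNReal.ofReal ((1 - t) * m) := ENNReal.ofReal_le_ofReal hta
        _ = ENNReal.ofReal (1 - t) * μ Γ := by rw [hmΓ, ENNReal.ofReal_mul h1t]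
        _ ≤ ρ Γ := by simp [hρ]
    have h := hm ρ hmem
    rw [wEnergy_eq_mutualEnergy ρ, hρ, mutualEnergy_add_smul, ← wEnergy_eq_mutualEnergy, ← wEnergy_eq_mutualEnergy, he, hxe, hf,
      show (2 : ℝ≥0∞) = ENNReal.ofReal 2 by simp, ← ENNReal.ofReal_mul (by positivity),
      ← ENNReal.ofReal_mul (by positivity), ← ENNReal.ofReal_mul (by positivity),
      ← ENNReal.ofReal_mul (by positivity), ← ENNReal.ofReal_mul (by positivity),
      ← ENNReal.ofReal_mul (by positivity), ← ENNReal.ofReal_mul (by positivity),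
      ← ENNReal.ofReal_add (by positivity) (by positivity),
      ← ENNReal.ofReal_add (by positivity) (by positivity)] at h
    exact (ENNReal.ofReal_le_ofReal_iff (by positivity)).1 h
  set δ := min (1 / 2) (min (1 - a / m) ((e - x) / (e + f + 1))) with hδ
  have hq : 0 < 1 - a / m := by
    rw [sub_pos, div_lt_one hmp]; exact ham
  have hd : 0 < (e - x) / (e + f + 1) := div_pos (by linarith) (by linarith)
  have hδ0 : 0 < δ := by positivity
  have hδ1 : δ ≤ 1 / 2 := min_le_left _ _
  have hδ2 : δ ≤ 1 - a / m := (min_le_right _ _).trans (min_le_left _ _)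
  have hδ3 : δ ≤ (e - x) / (e + f + 1) := (min_le_right _ _).trans (min_le_right _ _)
  have h := key δ hδ0 (by linarith) (by
    have : a / m ≤ 1 - δ := by linarith
    rwa [div_le_iff₀ hmp] at this)
  rw [le_div_iff₀ (by linarith)] at hδ3
  have h' : 0 ≤ δ * (-(2 * e) + δ * e + 2 * (1 - δ) * x + δ * f) := by linarith
  have h'' := nonneg_of_mul_nonneg_right h' hδ0
  nlinarith [mul_nonneg hδ0.le hx0]

/-- The potential of a minimizer with inactive constraint is almost everywhere at most the
energy. -/
lemma IsMinimizer.ae_potential_le {Γ : Set Plane} {a : ℝ} (ha : 0 < a) {μ : Measure Plane}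
    (hmin : IsMinimizer Γ a μ) (hlt : ENNReal.ofReal a < μ Γ) :
    ∀ᵐ x ∂μ, ∫⁻ y, wKernel x y ∂μ ≤ wEnergy μ := by
  have hp : IsProbabilityMeasure μ := hmin.1.1
  have hE := hmin.2.1
  have hU := measurable_potential μ
  set S := {x | ∫⁻ y, wKernel x y ∂μ < wEnergy μ}
  have hS : MeasurableSet S := measurableSet_lt hU measurable_const
  have hS0 : μ S = 0 := by
    by_contra hS0
    have hinv : (μ S)⁻¹ ≠ ⊤ := ENNReal.inv_ne_top.2 hS0
    set ν := (μ S)⁻¹ • μ.restrict S with hν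
    have hνp : IsProbabilityMeasure ν := ⟨by
      simp [hν, ENNReal.inv_mul_cancel hS0 (measure_ne_top _ _)]⟩
    have hle : mutualEnergy ν ν ≤ (μ S)⁻¹ * ((μ S)⁻¹ * mutualEnergy μ μ) := by
      simp only [hν, mutualEnergy, lintegral_smul_measure, smul_eq_mul]
      rw [lintegral_const_mul _ (measurable_potential _)]
      gcongr <;> exact Measure.restrict_le_self
    have hνE : wEnergy ν < ⊤ := by
      rw [wEnergy_eq_mutualEnergy]
      rw [wEnergy_eq_mutualEnergy] at hE
      exact hle.trans_lt (ENNReal.mul_lt_top hinv.lt_top (ENNReal.mul_lt_top hinv.lt_top hE))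
    have h1 := hmin.wEnergy_le_mutualEnergy ha hlt ν hνE
    have h2 : ∫⁻ x in S, ∫⁻ y, wKernel x y ∂μ ∂μ < ∫⁻ x in S, wEnergy μ ∂μ := by
      refine lintegral_strict_mono_of_ae_le_of_ae_lt_on (s := S) aemeasurable_const ?_ ?_ ?_ ?_
      · refine ((lintegral_mono' Measure.restrict_le_self le_rfl).trans_lt ?_).ne
        rw [wEnergy_eq_mutualEnergy] at hE
        exact hE
      · exact (ae_restrict_iff' hS).2 (Filter.Eventually.of_forall fun x hx => le_of_lt hx)
      · simpa using hS0
      · exact Filter.Eventually.of_forall fun x hx => hx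
    have h3 : mutualEnergy ν μ < wEnergy μ := by
      simp only [hν, mutualEnergy, lintegral_smul_measure, smul_eq_mul]
      rw [lintegral_const, Measure.restrict_apply_univ] at h2
      calc _ < (μ S)⁻¹ * (wEnergy μ * μ S) :=
            ENNReal.mul_lt_mul_right (ENNReal.inv_ne_zero.2 (measure_ne_top _ _)) hinv h2
        _ = wEnergy μ * ((μ S)⁻¹ * μ S) := by ring
        _ = wEnergy μ := by rw [ENNReal.inv_mul_cancel hS0 (measure_ne_top _ _), mul_one]
    exact h1.not_gt h3
  have hge : (fun _ => wEnergy μ) ≤ᵐ[μ] fun x => ∫⁻ y, wKernel x y ∂μ := by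
    filter_upwards [measure_eq_zero_iff_ae_notMem.1 hS0] with x hx
    exact not_lt.1 hx
  have := ae_eq_of_ae_le_of_lintegral_le hge (by simpa using hE.ne) hU.aemeasurable
    (by simp [wEnergy_eq_mutualEnergy, mutualEnergy])
  filter_upwards [this] with x hx
  exact hx.symm.le

/-- The identification of `ℂ` with the plane. -/
noncomputable def complexPlane : ℂ ≃ₗᵢ[ℝ] Plane := Complex.orthonormalBasisOneI.repr

/-- The uniform probability measure on the circle with center `c` and radius `r`. -/
noncomputable def circleMeasure (c : ℂ) (r : ℝ) : Measure Plane :=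
  (ENNReal.ofReal (2 * π)⁻¹ • (volume.restrict (Set.Ioc 0 (2 * π)))).map
    (fun θ => complexPlane (circleMap c r θ))

lemma measurable_complexPlane_circleMap (c : ℂ) (r : ℝ) :
    Measurable (fun θ => complexPlane (circleMap c r θ)) :=
  (complexPlane.continuous.comp (continuous_circleMap c r)).measurable

instance (c : ℂ) (r : ℝ) : IsProbabilityMeasure (circleMeasure c r) := by
  constructor
  rw [circleMeasure, Measure.map_apply (measurable_complexPlane_circleMap c r) .univ]
  simp only [Set.preimage_univ, Measure.smul_apply, Measure.restrict_apply_univ, Real.volume_Ioc,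
    smul_eq_mul, sub_zero]
  rw [← ENNReal.ofReal_mul (by positivity), inv_mul_cancel₀ (by positivity), ENNReal.ofReal_one]

lemma lintegral_circleMeasure (c : ℂ) (r : ℝ) {f : Plane → ℝ≥0∞} (hf : Measurable f) :
    ∫⁻ x, f x ∂circleMeasure c r =
      ENNReal.ofReal (2 * π)⁻¹ * ∫⁻ θ in Set.Ioc 0 (2 * π), f (complexPlane (circleMap c r θ)) := by
  rw [circleMeasure, lintegral_map hf (measurable_complexPlane_circleMap c r),
    lintegral_smul_measure, smul_eq_mul]

lemma circleAverage_norm_sq (c : ℂ) (r : ℝ) :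
    circleAverage (fun z => ‖z‖ ^ 2) c r = ‖c‖ ^ 2 + r ^ 2 := by
  have h : ∀ θ : ℝ, ‖circleMap c r θ‖ ^ 2 =
      (‖c‖ ^ 2 + r ^ 2) + 2 * r * (c.re * Real.cos θ + c.im * Real.sin θ) := by
    intro θ
    rw [← Complex.normSq_eq_norm_sq, ← Complex.normSq_eq_norm_sq, Complex.normSq_apply,
      Complex.normSq_apply]
    simp only [circleMap, Complex.add_re, Complex.add_im, Complex.re_ofReal_mul,
      Complex.im_ofReal_mul, Complex.exp_ofReal_mul_I_re, Complex.exp_ofReal_mul_I_im]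
    linear_combination r ^ 2 * Real.sin_sq_add_cos_sq θ
  rw [circleAverage_def]
  simp only [h]
  rw [intervalIntegral.integral_add (by simp) (by apply Continuous.intervalIntegrable; fun_prop),
    intervalIntegral.integral_const_mul,
    intervalIntegral.integral_add (by apply Continuous.intervalIntegrable; fun_prop)
      (by apply Continuous.intervalIntegrable; fun_prop)]
  simp
  field_simp

lemma logKernel_complexPlane (z y : ℂ) :
    logKernel (complexPlane z) (complexPlane y) = -Real.log ‖z - y‖ := by
  rw [logKernel, LinearIsometryEquiv.dist_map, one_div, Real.log_inv, dist_eq_norm]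

lemma lintegral_wKernel_circleMeasure (c y : ℂ) {r : ℝ} (hr : 0 < r) :
    ∫⁻ x, wKernel x (complexPlane y) ∂circleMeasure c r =
      ENNReal.ofReal (-(Real.log r + Real.posLog (r⁻¹ * ‖c - y‖)) +
        (‖c‖ ^ 2 + r ^ 2 + ‖y‖ ^ 2) / 2 + 1) := by
  have hm : Measurable (fun x => wKernel x (complexPlane y)) :=
    measurable_wKernel.comp (measurable_id.prodMk measurable_const)
  rw [lintegral_circleMeasure c r hm]
  set F : ℂ → ℝ := fun z => -Real.log ‖z - y‖ + (‖z‖ ^ 2 + ‖y‖ ^ 2) / 2 + 1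
  have hF : ∀ z : ℂ, logKernel (complexPlane z) (complexPlane y) +
      (‖complexPlane z‖ ^ 2 + ‖complexPlane y‖ ^ 2) / 2 + 1 = F z := by
    intro z
    simp only [logKernel_complexPlane, LinearIsometryEquiv.norm_map, F]
  have hF0 : ∀ z, 0 ≤ F z := fun z => by rw [← hF]; exact logKernel_add_nonneg _ _
  have hlog : IntervalIntegrable (fun θ => Real.log ‖circleMap c r θ - y‖) volume 0 (2 * π) :=
    circleIntegrable_log_norm_sub_const r
  have hlogn : IntervalIntegrable (fun θ => -Real.log ‖circleMap c r θ - y‖) volume 0 (2 * π) :=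
    hlog.neg
  have hsq : IntervalIntegrable (fun θ => ‖circleMap c r θ‖ ^ 2) volume 0 (2 * π) := by
    apply Continuous.intervalIntegrable
    fun_prop
  have hsq' : IntervalIntegrable (fun θ => (‖circleMap c r θ‖ ^ 2 + ‖y‖ ^ 2) / 2) volume
      0 (2 * π) := (hsq.add intervalIntegrable_const).div_const 2
  have hFi : IntervalIntegrable (fun θ => F (circleMap c r θ)) volume 0 (2 * π) :=
    (hlogn.add hsq').add intervalIntegrable_const
  have hFavg : circleAverage F c r = -(Real.log r + Real.posLog (r⁻¹ * ‖c - y‖)) +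
        (‖c‖ ^ 2 + r ^ 2 + ‖y‖ ^ 2) / 2 + 1 := by
    rw [← circleAverage_log_norm_sub_const_eq_log_radius_add_posLog hr.ne',
      ← circleAverage_norm_sq]
    simp only [circleAverage_def, F, smul_eq_mul]
    rw [intervalIntegral.integral_add (hlogn.add hsq') intervalIntegrable_const,
      intervalIntegral.integral_add hlogn hsq', intervalIntegral.integral_neg,
      intervalIntegral.integral_div, intervalIntegral.integral_add hsq intervalIntegrable_const]
    simp only [intervalIntegral.integral_const, smul_eq_mul, sub_zero]
    field_simp
  have hcongr : ∫⁻ θ in Set.Ioc 0 (2 * π),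
        wKernel (complexPlane (circleMap c r θ)) (complexPlane y) =
      ∫⁻ θ in Set.Ioc 0 (2 * π), ENNReal.ofReal (F (circleMap c r θ)) := by
    apply lintegral_congr_ae
    have hnull : volume (circleMap c r ⁻¹' {y}) = 0 :=
      ((Set.countable_singleton y).preimage_circleMap c hr.ne').measure_zero _
    filter_upwards [ae_restrict_of_ae (measure_eq_zero_iff_ae_notMem.1 hnull)] with θ hθ
    have hne : complexPlane (circleMap c r θ) ≠ complexPlane y := fun h =>
      hθ (complexPlane.injective h)
    rw [wKernel, if_neg hne, hF]
  rw [hcongr, ← ofReal_integral_eq_lintegral_ofReal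
    ((intervalIntegrable_iff_integrableOn_Ioc_of_le (by positivity)).1 hFi)
    (Filter.Eventually.of_forall fun θ => hF0 _), ← ENNReal.ofReal_mul (by positivity),
    ← intervalIntegral.integral_of_le (by positivity), ← hFavg, circleAverage_def, smul_eq_mul]

lemma wEnergy_circleMeasure_lt_top (c : ℂ) {r : ℝ} (hr : 0 < r) :
    wEnergy (circleMeasure c r) < ⊤ := by
  rw [wEnergy_eq_mutualEnergy, mutualEnergy]
  have h : ∀ y : Plane, ∫⁻ x, wKernel y x ∂circleMeasure c r ≤
      ENNReal.ofReal (-Real.log r + (‖c‖ ^ 2 + r ^ 2 + ‖y‖ ^ 2) / 2 + 1) := by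
    intro y
    obtain ⟨z, rfl⟩ := complexPlane.surjective y
    simp only [wKernel_comm (complexPlane z)]
    rw [lintegral_wKernel_circleMeasure c z hr, LinearIsometryEquiv.norm_map]
    apply ENNReal.ofReal_le_ofReal
    linarith [Real.posLog_nonneg (x := r⁻¹ * ‖c - z‖)]
  refine (lintegral_mono h).trans_lt ?_
  rw [lintegral_circleMeasure c r (by fun_prop)]
  simp only [LinearIsometryEquiv.norm_map]
  have hcont : Continuous fun θ : ℝ =>
      -Real.log r + (‖c‖ ^ 2 + r ^ 2 + ‖circleMap c r θ‖ ^ 2) / 2 + 1 := by fun_prop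
  exact ENNReal.mul_lt_top ENNReal.ofReal_lt_top
    (((hcont.integrableOn_Icc (a := 0) (b := 2 * π)).mono_set Set.Ioc_subset_Icc_self).lintegral_lt_top)

/-- Spreading a unit point mass over the circle of radius `r` lowers the potential by at least one
near the center, at the price of `r ^ 2 / 2`. -/
lemma lintegral_wKernel_circleMeasure_add_indicator_le (c : ℂ) {r : ℝ} (hr : 0 < r) (y : Plane) :
    ∫⁻ x, wKernel x y ∂circleMeasure c r +
        (Metric.closedBall (complexPlane c) (r * Real.exp (-1))).indicator 1 y ≤
      wKernel (complexPlane c) y + ENNReal.ofReal (r ^ 2 / 2) := by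
  obtain ⟨y, rfl⟩ := complexPlane.surjective y
  rcases eq_or_ne c y with rfl | hcy
  · simp [wKernel]
  have hd : 0 < ‖c - y‖ := norm_pos_iff.2 (sub_ne_zero.2 hcy)
  have hne : complexPlane c ≠ complexPlane y := fun h => hcy (complexPlane.injective h)
  have hn := logKernel_add_nonneg (complexPlane c) (complexPlane y)
  rw [lintegral_wKernel_circleMeasure c y hr, wKernel, if_neg hne,
    ← ENNReal.ofReal_add hn (by positivity)]
  simp only [logKernel_complexPlane, LinearIsometryEquiv.norm_map] at hn ⊢
  have hlog : Real.log (r⁻¹ * ‖c - y‖) = -Real.log r + Real.log ‖c - y‖ := by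
    rw [Real.log_mul (by positivity) hd.ne', Real.log_inv]
  have hpos : Real.log (r⁻¹ * ‖c - y‖) ≤ Real.posLog (r⁻¹ * ‖c - y‖) := le_max_right _ _
  by_cases hy : complexPlane y ∈ Metric.closedBall (complexPlane c) (r * Real.exp (-1))
  · rw [Set.indicator_of_mem hy, Pi.one_apply, ← ENNReal.ofReal_one]
    rw [Metric.mem_closedBall, dist_comm, LinearIsometryEquiv.dist_map, dist_eq_norm] at hy
    have h1 : Real.log ‖c - y‖ ≤ Real.log r - 1 := by
      have := Real.log_le_log hd hy
      rw [Real.log_mul hr.ne' (Real.exp_ne_zero _), Real.log_exp] at this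
      linarith
    have h0 := Real.posLog_nonneg (x := r⁻¹ * ‖c - y‖)
    have h2 : Real.posLog (r⁻¹ * ‖c - y‖) = 0 := by
      rw [Real.posLog_apply, hlog]
      exact max_eq_left (by linarith)
    have hr1 := Real.log_le_sub_one_of_pos hr
    rw [h2, ← ENNReal.ofReal_add
      (by nlinarith [sq_nonneg (r - 1), sq_nonneg ‖c‖, sq_nonneg ‖y‖]) zero_le_one]
    apply ENNReal.ofReal_le_ofReal
    linarith
  · rw [Set.indicator_of_notMem hy, add_zero]
    apply ENNReal.ofReal_le_ofReal
    linarith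

lemma IsMinimizer.measure_closedBall_le {Γ : Set Plane} {a : ℝ} (ha : 0 < a) {μ : Measure Plane}
    (hmin : IsMinimizer Γ a μ) (hlt : ENNReal.ofReal a < μ Γ) {p : Plane}
    (hU : ∫⁻ y, wKernel p y ∂μ ≤ wEnergy μ) {r : ℝ} (hr : 0 < r) :
    μ (Metric.closedBall p (r * Real.exp (-1))) ≤ ENNReal.ofReal (r ^ 2 / 2) := by
  have hp : IsProbabilityMeasure μ := hmin.1.1
  obtain ⟨c, rfl⟩ := complexPlane.surjective p
  have h1 := hmin.wEnergy_le_mutualEnergy ha hlt (circleMeasure c r)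
    (wEnergy_circleMeasure_lt_top c hr)
  rw [mutualEnergy_comm] at h1
  have h2 := lintegral_mono (μ := μ) (lintegral_wKernel_circleMeasure_add_indicator_le c hr)
  rw [lintegral_add_right _ (measurable_one.indicator measurableSet_closedBall),
    lintegral_add_right _ measurable_const, lintegral_indicator_one measurableSet_closedBall,
    lintegral_const, measure_univ, mul_one] at h2
  have h3 : mutualEnergy μ (circleMeasure c r) =
      ∫⁻ y, ∫⁻ x, wKernel x y ∂circleMeasure c r ∂μ := by
    simp only [mutualEnergy]
    exact lintegral_congr fun y => lintegral_congr fun x => wKernel_comm y x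
  rw [← h3] at h2
  have h4 := (add_le_add_left h1 _).trans (h2.trans (add_le_add_left hU _))
  exact (ENNReal.add_le_add_iff_left hmin.2.1.ne).1 h4

lemma measure_range_eq_zero_of_lipschitz {γ : ℝ → Plane} (hγ : LipschitzWith 1 γ)
    {μ : Measure Plane} {G : Plane → Prop} (hG : ∀ᵐ x ∂μ, G x)
    (hball : ∀ p, G p → ∀ r : ℝ, 0 < r →
      μ (Metric.closedBall p (r * Real.exp (-1))) ≤ ENNReal.ofReal (r ^ 2 / 2)) :
    μ (Set.range γ) = 0 := by
  set C := Real.exp 1 ^ 2 / 2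
  have hC : 0 ≤ C := by positivity
  have hsmall : ∀ t h : ℝ, 0 < h → μ (γ '' Set.Icc t (t + h)) ≤ ENNReal.ofReal (C * h ^ 2) := by
    intro t h hh
    by_cases h0 : μ (γ '' Set.Icc t (t + h)) = 0
    · simp [h0]
    obtain ⟨_, ⟨s, hs, rfl⟩, hGs⟩ :=
      ((frequently_ae_mem_iff.2 h0).and_eventually hG).exists
    have hb := hball _ hGs (h * Real.exp 1) (by positivity)
    rw [mul_assoc, ← Real.exp_add, add_neg_cancel, Real.exp_zero, mul_one] at hb
    refine (measure_mono ?_).trans (hb.trans_eq (by congr 1; ring))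
    rintro _ ⟨u, hu, rfl⟩
    rw [Metric.mem_closedBall]
    have hd := hγ.dist_le_mul u s
    rw [NNReal.coe_one, one_mul, Real.dist_eq] at hd
    exact hd.trans (abs_sub_le_iff.2 ⟨by linarith [hu.2, hs.1], by linarith [hs.2, hu.1]⟩)
  have hmany : ∀ (t h : ℝ), 0 < h → ∀ n : ℕ,
      μ (γ '' Set.Icc t (t + (n + 1) * h)) ≤ ENNReal.ofReal ((n + 1) * (C * h ^ 2)) := by
    intro t h hh n
    induction n with
    | zero => simpa using hsmall t h hh
    | succ n ih =>
      have hsub : γ '' Set.Icc t (t + ((n + 1 : ℕ) + 1) * h) ⊆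
          γ '' Set.Icc t (t + (n + 1) * h) ∪
            γ '' Set.Icc (t + (n + 1) * h) (t + (n + 1) * h + h) := by
        rw [← Set.image_union]
        refine Set.image_mono fun x hx => ?_
        push_cast at hx
        rcases le_total x (t + (n + 1) * h) with h1 | h1
        · exact Or.inl ⟨hx.1, h1⟩
        · exact Or.inr ⟨h1, by linarith [hx.2]⟩
      calc _ ≤ _ := measure_mono hsub
        _ ≤ _ := measure_union_le _ _
        _ ≤ _ := add_le_add ih (hsmall _ h hh)
        _ = _ := by
          rw [← ENNReal.ofReal_add (by positivity) (by positivity)]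
          congr 1
          push_cast
          ring
  have hunit : ∀ t : ℝ, μ (γ '' Set.Icc t (t + 1)) = 0 := by
    intro t
    have hle : ∀ n : ℕ, μ (γ '' Set.Icc t (t + 1)) ≤ ENNReal.ofReal (C * (1 / ((n : ℝ) + 1))) := by
      intro n
      have := hmany t (1 / ((n : ℝ) + 1)) (by positivity) n
      have e1 : ((n : ℝ) + 1) * (1 / ((n : ℝ) + 1)) = 1 := by field_simp
      have e2 : ((n : ℝ) + 1) * (C * (1 / ((n : ℝ) + 1)) ^ 2) = C * (1 / ((n : ℝ) + 1)) := by
        field_simp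
      rwa [e1, e2] at this
    have hlim := ENNReal.tendsto_ofReal
      ((tendsto_one_div_add_atTop_nhds_zero_nat (𝕜 := ℝ)).const_mul C)
    rw [mul_zero, ENNReal.ofReal_zero] at hlim
    exact le_antisymm (ge_of_tendsto' hlim hle) zero_le
  have hcover : Set.range γ ⊆ ⋃ k : ℤ, γ '' Set.Icc (k : ℝ) (k + 1) := by
    rintro _ ⟨t, rfl⟩
    exact Set.mem_iUnion.2 ⟨⌊t⌋, t, ⟨Int.floor_le t, (Int.lt_floor_add_one t).le⟩, rfl⟩
  exact measure_mono_null hcover (measure_iUnion_null fun k => hunit k)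

/-- every minimizer of `I` over `M_a` satisfies `μ_a(Γ) = a`. -/
theorem statement3 (γ : ℝ → Plane) (Γ : Set Plane) (hΓ : RegularCurve γ Γ)
    (a : ℝ) (ha : a ∈ Set.Ioo (0:ℝ) 1)
    (μa : Measure Plane) (hmin : IsMinimizer Γ a μa) :
    μa Γ = ENNReal.ofReal a := by
  have hp : IsProbabilityMeasure μa := hmin.1.1
  by_contra hne
  have hlt : ENNReal.ofReal a < μa Γ := lt_of_le_of_ne hmin.1.2 (Ne.symm hne)
  have hlip : LipschitzWith 1 γ :=
    lipschitzWith_of_nnnorm_deriv_le (hΓ.contDiff.differentiable one_ne_zero) fun t => by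
      rw [← NNReal.coe_le_coe]
      simp [hΓ.unitSpeed t]
  have h0 := measure_range_eq_zero_of_lipschitz hlip (hmin.ae_potential_le ha.1 hlt)
    fun p hp r hr => hmin.measure_closedBall_le ha.1 hlt hp hr
  rw [← hΓ.image] at h0
  simp [h0] at hlt
end

section
/- The topological support of the minimizer μ_a is compact; equivalently, there exists R > 0 such that μ_a({x ∈ ℝ² : |x| > R}) = 0. -/
open MeasureTheory Real
open scoped ENNReal

/-- The kernel dominates a quarter of the confining potential of either variable. -/
theorem ofReal_sq_norm_div_four_le_wKernel (x y : Plane) :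
    ENNReal.ofReal (‖x‖ ^ 2 / 4) ≤ wKernel x y := by
  unfold wKernel
  split_ifs with h
  · exact le_top
  · apply ENNReal.ofReal_le_ofReal
    have hd : 0 < dist x y := dist_pos.mpr h
    have hlog : Real.log (dist x y / 2) ≤ dist x y / 2 - 1 :=
      Real.log_le_sub_one_of_pos (by positivity)
    rw [Real.log_div hd.ne' two_ne_zero] at hlog
    have hlog2 := Real.log_two_lt_d9
    have htri : dist x y ≤ ‖x‖ + ‖y‖ := by
      rw [dist_eq_norm]
      exact norm_sub_le x y
    simp only [logKernel, one_div, Real.log_inv]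
    nlinarith [sq_nonneg (‖x‖ - 1), sq_nonneg (‖y‖ - 1)]

/-- Splitting off the mass outside `A`, where `‖x‖ ≥ R`, costs energy at least `R ^ 2 / 4` per unit
mass. -/
theorem setLIntegral_wKernel_add_le_wEnergy (μ : Measure Plane) [IsProbabilityMeasure μ] {R : ℝ}
    (hR : 0 ≤ R) {A : Set Plane} (hA : MeasurableSet A) (hAR : ∀ x ∉ A, R ≤ ‖x‖) :
    ∫⁻ p in A ×ˢ A, wKernel p.1 p.2 ∂(μ.prod μ) + ENNReal.ofReal (R ^ 2 / 4) * μ Aᶜ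
      ≤ wEnergy μ := by
  have hB : MeasurableSet (Aᶜ ×ˢ (Set.univ : Set Plane)) := hA.compl.prod MeasurableSet.univ
  have hdisj : Disjoint (A ×ˢ A) (Aᶜ ×ˢ (Set.univ : Set Plane)) := by
    rw [Set.disjoint_left]
    rintro p hp hq
    exact hq.1 hp.1
  have hlow : ENNReal.ofReal (R ^ 2 / 4) * μ Aᶜ
      ≤ ∫⁻ p in Aᶜ ×ˢ (Set.univ : Set Plane), wKernel p.1 p.2 ∂(μ.prod μ) := by
    calc ENNReal.ofReal (R ^ 2 / 4) * μ Aᶜ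
        = ∫⁻ _ in Aᶜ ×ˢ (Set.univ : Set Plane), ENNReal.ofReal (R ^ 2 / 4) ∂(μ.prod μ) := by
          rw [setLIntegral_const, Measure.prod_prod, measure_univ, mul_one]
      _ ≤ _ := by
          refine setLIntegral_mono' hB fun p hp => ?_
          refine le_trans (ENNReal.ofReal_le_ofReal ?_) (ofReal_sq_norm_div_four_le_wKernel _ _)
          have := hAR p.1 hp.1
          gcongr
  calc _ ≤ _ := add_le_add_right hlow _
    _ = ∫⁻ p in A ×ˢ A ∪ Aᶜ ×ˢ Set.univ, wKernel p.1 p.2 ∂(μ.prod μ) :=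
        (lintegral_union hB hdisj).symm
    _ ≤ wEnergy μ := setLIntegral_le_lintegral _ _

/-- Adding `t` times the restriction of `μ` to `G` changes the energy of the restriction of `μ`
to `A` by at most `(2 * t + t ^ 2) * wEnergy μ`. -/
theorem wEnergy_restrict_add_smul_restrict_le (μ : Measure Plane) [IsProbabilityMeasure μ]
    (A G : Set Plane) {t : ℝ≥0∞} (ht : t ≠ ⊤) :
    wEnergy (μ.restrict A + t • μ.restrict G)
      ≤ ∫⁻ p in A ×ˢ A, wKernel p.1 p.2 ∂(μ.prod μ) + (2 * t + t * t) * wEnergy μ := by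
  have hle : ∀ S : Set (Plane × Plane), ∫⁻ p in S, wKernel p.1 p.2 ∂(μ.prod μ) ≤ wEnergy μ :=
    fun S => setLIntegral_le_lintegral _ _
  have : IsFiniteMeasure (t • μ.restrict G) := Measure.smul_finite _ ht
  have key : wEnergy (μ.restrict A + t • μ.restrict G)
      = ∫⁻ p in A ×ˢ A, wKernel p.1 p.2 ∂(μ.prod μ)
        + t * ∫⁻ p in A ×ˢ G, wKernel p.1 p.2 ∂(μ.prod μ)
        + (t * ∫⁻ p in G ×ˢ A, wKernel p.1 p.2 ∂(μ.prod μ)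
        + t * (t * ∫⁻ p in G ×ˢ G, wKernel p.1 p.2 ∂(μ.prod μ))) := by
    simp only [wEnergy, Measure.add_prod, Measure.prod_add, Measure.prod_smul_left,
      Measure.prod_smul_right, Measure.prod_restrict, lintegral_add_measure,
      lintegral_smul_measure, smul_eq_mul, mul_add]
    ring
  rw [key]
  calc _ ≤ ∫⁻ p in A ×ˢ A, wKernel p.1 p.2 ∂(μ.prod μ) + t * wEnergy μ
        + (t * wEnergy μ + t * (t * wEnergy μ)) := by
        gcongr <;> exact hle _
    _ = _ := by ring

/-- the support of the minimizer `μ_a` is compact: there is `R > 0`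
with `μ_a({x : |x| > R}) = 0`. -/
theorem statement7 (γ : ℝ → Plane) (Γ : Set Plane) (hΓ : RegularCurve γ Γ)
    (a : ℝ) (ha : a ∈ Set.Ioo (0:ℝ) 1)
    (μa : Measure Plane) (hmin : IsMinimizer Γ a μa) :
    ∃ R : ℝ, 0 < R ∧ μa {x : Plane | R < ‖x‖} = 0 := by
  obtain ⟨⟨hprob, hmass⟩, hfin, hopt⟩ := hmin
  have hΓmeas : MeasurableSet Γ := hΓ.closed.measurableSet
  have hm0 : μa Γ ≠ 0 := ((ENNReal.ofReal_pos.mpr ha.1).trans_le hmass).ne'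
  have hmtop : μa Γ ≠ ⊤ := measure_ne_top _ _
  set c : ℝ≥0∞ := (μa Γ)⁻¹ with hc
  have hctop : c ≠ ⊤ := ENNReal.inv_ne_top.mpr hm0
  set C : ℝ≥0∞ := (2 * c + c * c) * wEnergy μa with hC
  have hCtop : C ≠ ⊤ := by finiteness
  obtain ⟨R, hR0, hRC⟩ : ∃ R : ℝ, 0 < R ∧ C < ENNReal.ofReal (R ^ 2 / 4) := by
    have h0 : 0 ≤ C.toReal := ENNReal.toReal_nonneg
    refine ⟨4 * (C.toReal + 1), by positivity, ?_⟩
    rw [ENNReal.lt_ofReal_iff_toReal_lt hCtop]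
    nlinarith
  refine ⟨R, hR0, ?_⟩
  set A : Set Plane := {x | ‖x‖ ≤ R} with hAdef
  have hA : MeasurableSet A := (isClosed_le continuous_norm continuous_const).measurableSet
  have hAc : {x : Plane | R < ‖x‖} = Aᶜ := by ext x; simp [hAdef]
  rw [hAc]
  by_contra hε
  set ε := μa Aᶜ with hεdef
  have hε1 : ε ≤ 1 := prob_le_one
  have hcm : c * μa Γ = 1 := ENNReal.inv_mul_cancel hm0 hmtop
  have hν : μa.restrict A + (ε * c) • μa.restrict Γ ∈ Ma Γ a := by
    refine ⟨⟨?_⟩, hmass.trans ?_⟩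
    · simp [mul_assoc, hcm, hεdef, measure_add_measure_compl hA]
    · simp only [Measure.add_apply, Measure.smul_apply,
        Measure.restrict_apply_self, smul_eq_mul, mul_assoc, hcm, mul_one]
      calc μa Γ = μa (Γ ∩ A) + μa (Γ \ A) := (measure_inter_add_sdiff Γ hA).symm
        _ ≤ _ := by
          rw [Measure.restrict_apply' hA]
          exact add_le_add_right (measure_mono fun x hx => hx.2) _
  have htop : ε * c ≠ ⊤ := ENNReal.mul_ne_top (measure_ne_top _ _) hctop
  have hchain := (setLIntegral_wKernel_add_le_wEnergy μa hR0.le hA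
    (fun x hx => (not_le.mp hx).le)).trans
    ((hopt _ hν).trans (wEnergy_restrict_add_smul_restrict_le μa A Γ htop))
  have hAA : ∫⁻ p in A ×ˢ A, wKernel p.1 p.2 ∂(μa.prod μa) ≠ ⊤ :=
    ((setLIntegral_le_lintegral _ _).trans_lt hfin).ne
  have hcancel := (ENNReal.add_le_add_iff_left hAA).mp hchain
  have hup : (2 * (ε * c) + ε * c * (ε * c)) * wEnergy μa ≤ C * ε := by
    calc _ = (2 * c + ε * (c * c)) * wEnergy μa * ε := by ring
      _ ≤ (2 * c + 1 * (c * c)) * wEnergy μa * ε := by gcongr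
      _ = C * ε := by rw [one_mul]
  exact absurd (hcancel.trans hup)
    (not_le.mpr ((ENNReal.mul_lt_mul_iff_left hε (measure_ne_top _ _)).mpr hRC))
end
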